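/- arXiv:q-alg/9707012 — 5 statements merged into one kernel-verified Lean document; each statement's English description precedes it below -/
import Mathlib

section
/- Let A be a Hopf algebra over a commutative ring K with comultiplication Δ, counit ε and antipode S, assume S is bijective, and let 𝓡 be a quasitriangular structure on A. Write 𝓡⁻¹ = Σᵢ cᵢ ⊗ dᵢ (a finite sum in A ⊗ A) and set u = Σᵢ dᵢ·S(cᵢ); intrinsically, u is the image of 𝓡⁻¹ under the composite of the flip τ of A ⊗ A, the map id ⊗ S, and the multiplication map A ⊗ A → A. Then u is a unit of A and S⁻²(x) = u·x·u⁻¹ for every x ∈ A, where S⁻¹ denotes the inverse of the antipode. -/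
open TensorProduct

noncomputable section

variable {K A : Type*} [CommRing K] [Ring A] [HopfAlgebra K A]

/-- `a ⊗ b ↦ a ⊗ b ⊗ 1` -/
def iota12 : A ⊗[K] A →ₐ[K] A ⊗[K] (A ⊗[K] A) :=
  Algebra.TensorProduct.map (AlgHom.id K A) Algebra.TensorProduct.includeLeft

/-- `a ⊗ b ↦ a ⊗ 1 ⊗ b` -/
def iota13 : A ⊗[K] A →ₐ[K] A ⊗[K] (A ⊗[K] A) :=
  Algebra.TensorProduct.map (AlgHom.id K A) Algebra.TensorProduct.includeRight

/-- `a ⊗ b ↦ 1 ⊗ a ⊗ b` -/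
def iota23 : A ⊗[K] A →ₐ[K] A ⊗[K] (A ⊗[K] A) :=
  Algebra.TensorProduct.includeRight

/-- `𝓡` is a quasitriangular structure on the Hopf algebra `A`: it is invertible,
intertwines the comultiplication with its opposite, and satisfies the hexagon
identities `(Δ ⊗ id)(𝓡) = 𝓡₁₃𝓡₂₃`, `(id ⊗ Δ)(𝓡) = 𝓡₁₃𝓡₁₂`. -/
def IsQuasitriangular (R : A ⊗[K] A) : Prop :=
  IsUnit R ∧
  (∀ x : A, (Algebra.TensorProduct.comm K A A) (Coalgebra.comul x) * R
      = R * (Coalgebra.comul (R := K) x)) ∧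
  (TensorProduct.assoc K A A A)
      ((TensorProduct.map (Coalgebra.comul (R := K)) LinearMap.id) R)
    = iota13 (K := K) R * iota23 (K := K) R ∧
  (TensorProduct.map LinearMap.id (Coalgebra.comul (R := K))) R
    = iota13 (K := K) R * iota12 (K := K) R

/-- Drinfeld's element `u = Σ dᵢ · S(cᵢ)`, where `𝓡⁻¹ = Σ cᵢ ⊗ dᵢ`: the image of `𝓡⁻¹`
under the composite of the flip, `id ⊗ S`, and the multiplication map. -/
def drinfeldU (Rinv : A ⊗[K] A) : A :=
  LinearMap.mul' K A
    ((TensorProduct.map LinearMap.id (HopfAlgebra.antipode (R := K)))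
      ((TensorProduct.comm K A A) Rinv))

namespace DrinfeldElement

open Coalgebra HopfAlgebra

@[simp]
lemma drinfeldU_tmul (a b : A) :
    drinfeldU (K := K) (a ⊗ₜ[K] b) = b * antipode K a := by
  simp [drinfeldU]

@[simp]
lemma drinfeldU_zero : drinfeldU (K := K) (0 : A ⊗[K] A) = 0 := by
  simp [drinfeldU]

@[simp]
lemma drinfeldU_add (s t : A ⊗[K] A) :
    drinfeldU (K := K) (s + t) = drinfeldU (K := K) s + drinfeldU (K := K) t := by
  simp [drinfeldU]

@[simp]
lemma drinfeldU_one : drinfeldU (K := K) (1 : A ⊗[K] A) = 1 := by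
  simp [Algebra.TensorProduct.one_def]

/-- The linear map `a ⊗ b ↦ b * y * S(a)`. -/
def sandwich (y : A) : A ⊗[K] A →ₗ[K] A :=
  LinearMap.mul' K A ∘ₗ (TensorProduct.comm K A A).toLinearMap ∘ₗ
    TensorProduct.map (antipode K) (LinearMap.mulRight K y)

@[simp]
lemma sandwich_tmul (y a b : A) :
    sandwich (K := K) y (a ⊗ₜ[K] b) = b * y * antipode K a := by
  simp [sandwich]

lemma drinfeldU_mul (s t : A ⊗[K] A) :
    drinfeldU (K := K) (s * t) = sandwich (drinfeldU (K := K) t) s := by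
  induction s with
  | zero => simp
  | add s₁ s₂ h₁ h₂ => simp [add_mul, h₁, h₂]
  | tmul a b =>
    induction t with
    | zero => simp
    | add t₁ t₂ h₁ h₂ => simp_all [mul_add, add_mul]
    | tmul c d => simp [antipode_mul_antidistrib, mul_assoc]

lemma sandwich_algebraMap (k : K) (t : A ⊗[K] A) :
    sandwich (algebraMap K A k) t = k • drinfeldU (K := K) t := by
  induction t with
  | zero => simp
  | add s t hs ht => simp [hs, ht]
  | tmul a b => simp [Algebra.algebraMap_eq_smul_one]

lemma drinfeldU_comm_comul (x : A) :
    drinfeldU (K := K) (TensorProduct.comm K A A (comul x)) = algebraMap K A (counit x) := by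
  rw [← mul_antipode_lTensor_comul_apply]
  induction comul (R := K) x with
  | zero => simp
  | add s t hs ht => simp only [map_add, drinfeldU_add, hs, ht]
  | tmul a b => simp

/-- If `T` intertwines the opposite comultiplication with the comultiplication, then
`∑ x₂ * u * S(x₁) = ε(x) u` for `u` the Drinfeld element of `T`. -/
lemma sandwich_drinfeldU_comul {T : A ⊗[K] A}
    (hT : ∀ x : A, T * TensorProduct.comm K A A (comul x) = comul (R := K) x * T) (x : A) :
    sandwich (K := K) (drinfeldU (K := K) T) (comul x) =
      counit (R := K) x • drinfeldU (K := K) T := by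
  rw [← drinfeldU_mul, ← hT, drinfeldU_mul, drinfeldU_comm_comul, sandwich_algebraMap]

/-- If `T` intertwines the opposite comultiplication with the comultiplication, then
`x * u = u * S²(x)` for `u` the Drinfeld element of `T`. -/
lemma mul_drinfeldU {T : A ⊗[K] A}
    (hT : ∀ x : A, T * TensorProduct.comm K A A (comul x) = comul (R := K) x * T) (x : A) :
    x * drinfeldU (K := K) T = drinfeldU (K := K) T * antipode K (antipode K x) := by
  set u := drinfeldU (K := K) T with hu
  have h := congr((LinearMap.mul' K A ∘ₗ (TensorProduct.comm K A A).toLinearMap ∘ₗ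
    TensorProduct.map (antipode K ∘ₗ antipode K) (sandwich u))
    $(sum_tmul_tmul_eq (ℛ K x) (fun i ↦ ℛ K ((ℛ K x).left i))
      (fun i ↦ ℛ K ((ℛ K x).right i))))
  have hl (i) : ∑ j ∈ (ℛ K ((ℛ K x).left i)).index,
      (ℛ K x).right i * u * antipode K ((ℛ K ((ℛ K x).left i)).right j) *
        antipode K (antipode K ((ℛ K ((ℛ K x).left i)).left j)) =
      counit (R := K) ((ℛ K x).left i) • (ℛ K x).right i * u := by
    simp_rw [mul_assoc _ (antipode K _), ← antipode_mul_antidistrib, ← Finset.mul_sum, ← map_sum,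
      sum_antipode_mul_eq_smul]
    simp
  have hr (i) : ∑ j ∈ (ℛ K ((ℛ K x).right i)).index,
      (ℛ K ((ℛ K x).right i)).right j * u * antipode K ((ℛ K ((ℛ K x).right i)).left j) *
        antipode K (antipode K ((ℛ K x).left i)) =
      u * antipode K (antipode K (counit (R := K) ((ℛ K x).right i) • (ℛ K x).left i)) := by
    simp_rw [← Finset.sum_mul, ← sandwich_tmul, ← map_sum, (ℛ K ((ℛ K x).right i)).eq, hu,
      sandwich_drinfeldU_comul hT]
    simp
  have hx : ∑ i ∈ (ℛ K x).index, counit (R := K) ((ℛ K x).right i) • (ℛ K x).left i = x := by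
    simpa only [map_sum, TensorProduct.rid_tmul, one_smul] using
      congr(TensorProduct.rid K A $(sum_tmul_counit_eq (ℛ K x)))
  simp only [map_sum, LinearMap.comp_apply, TensorProduct.map_tmul, sandwich_tmul,
    LinearEquiv.coe_coe, TensorProduct.comm_tmul, LinearMap.mul'_apply, hl, hr] at h
  rwa [← Finset.sum_mul, ← Finset.mul_sum, ← map_sum, ← map_sum, hx, sum_counit_smul] at h

/-- If `u * S²(x) = x * u` for all `x`, then `∑ b * u * S(a) = u * ∑ S²(b) * S(a)`
is a right multiple of `u`. -/
lemma exists_mul_eq_sandwich {u : A} (hu : ∀ x : A, x * u = u * antipode K (antipode K x))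
    (t : A ⊗[K] A) : ∃ v : A, u * v = sandwich (K := K) u t := by
  induction t with
  | zero => exact ⟨0, by simp⟩
  | add s t hs ht =>
    obtain ⟨v, hv⟩ := hs
    obtain ⟨w, hw⟩ := ht
    exact ⟨v + w, by simp [mul_add, hv, hw]⟩
  | tmul a b => exact ⟨antipode K (antipode K b) * antipode K a, by simp [hu, mul_assoc]⟩

/-- If `u * S²(x) = x * u` for all `x` and `S` is surjective, then
`∑ b * u * S(a) = (∑ b * S⁻¹(a)) * u` is a left multiple of `u`. -/
lemma exists_mul_eq_sandwich_of_surjective {u : A}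
    (hu : ∀ x : A, x * u = u * antipode K (antipode K x))
    (hS : Function.Surjective (antipode K (A := A))) (t : A ⊗[K] A) :
    ∃ v : A, v * u = sandwich (K := K) u t := by
  induction t with
  | zero => exact ⟨0, by simp⟩
  | add s t hs ht =>
    obtain ⟨v, hv⟩ := hs
    obtain ⟨w, hw⟩ := ht
    exact ⟨v + w, by simp [add_mul, hv, hw]⟩
  | tmul a b =>
    obtain ⟨a, rfl⟩ := hS a
    exact ⟨b * a, by rw [sandwich_tmul, mul_assoc, hu a, mul_assoc]⟩

end DrinfeldElement

/-- If `𝓡` is a quasitriangular structure with inverse `𝓡⁻¹`, and the antipode `S` is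
bijective, then `u = Σ dᵢ S(cᵢ)` is a unit of `A` and `S⁻²(x) = u x u⁻¹` for all `x`. -/
theorem drinfeld_central_element
    (R Rinv : A ⊗[K] A) (hR : IsQuasitriangular (K := K) R)
    (hinv : R * Rinv = 1) (hinv' : Rinv * R = 1)
    (hS : Function.Bijective (HopfAlgebra.antipode (R := K) (A := A))) :
    ∃ v : A, drinfeldU (K := K) Rinv * v = 1 ∧ v * drinfeldU (K := K) Rinv = 1 ∧
      ∀ x : A,
        Function.invFun (HopfAlgebra.antipode (R := K) (A := A))
            (Function.invFun (HopfAlgebra.antipode (R := K) (A := A)) x)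
          = drinfeldU (K := K) Rinv * x * v := by
  have hT (x : A) : Rinv * TensorProduct.comm K A A (Coalgebra.comul x) =
      Coalgebra.comul x * Rinv := by
    have h : TensorProduct.comm K A A (Coalgebra.comul x) * R = R * Coalgebra.comul x :=
      hR.2.1 x
    calc Rinv * TensorProduct.comm K A A (Coalgebra.comul x)
        = Rinv * (TensorProduct.comm K A A (Coalgebra.comul x) * R) * Rinv := by
          rw [mul_assoc, mul_assoc, hinv, mul_one]
      _ = Coalgebra.comul x * Rinv := by rw [h, ← mul_assoc, hinv', one_mul]
  have hu := DrinfeldElement.mul_drinfeldU hT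
  have hs : DrinfeldElement.sandwich (drinfeldU (K := K) Rinv) R = 1 := by
    rw [← DrinfeldElement.drinfeldU_mul, hinv, DrinfeldElement.drinfeldU_one]
  obtain ⟨v, hv⟩ := DrinfeldElement.exists_mul_eq_sandwich hu R
  obtain ⟨w, hw⟩ := DrinfeldElement.exists_mul_eq_sandwich_of_surjective hu hS.2 R
  rw [hs] at hv hw
  obtain rfl : w = v := left_inv_eq_right_inv hw hv
  refine ⟨w, hv, hw, fun x ↦ ?_⟩
  obtain ⟨y, rfl⟩ := hS.2 x
  obtain ⟨z, rfl⟩ := hS.2 y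
  rw [Function.leftInverse_invFun hS.1, Function.leftInverse_invFun hS.1, ← hu, mul_assoc, hv,
    mul_one]

end
end

section
/- Let A be a Hopf algebra over a commutative ring K with antipode S, and let 𝓡 be a quasitriangular structure on A. Then (S ⊗ id)(𝓡) = 𝓡⁻¹ in A ⊗ A. -/
open TensorProduct

noncomputable section

variable {K A : Type*} [CommRing K] [Ring A] [HopfAlgebra K A]

/-- Convolution of linear endomorphisms of `A` becomes multiplication when evaluated on the first
leg of an element satisfying the first hexagon identity. -/
theorem map_convolution_id_of_comul_eq {R : A ⊗[K] A}
    (hR : (TensorProduct.assoc K A A A)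
        ((TensorProduct.map (Coalgebra.comul (R := K)) LinearMap.id) R)
      = iota13 (K := K) R * iota23 (K := K) R) (φ ψ : A →ₗ[K] A) :
    TensorProduct.map
        (LinearMap.mul' K A ∘ₗ TensorProduct.map φ ψ ∘ₗ Coalgebra.comul (R := K) (A := A))
        LinearMap.id R
      = TensorProduct.map φ LinearMap.id R * TensorProduct.map ψ LinearMap.id R := by
  have key (T U : A ⊗[K] A) :
      TensorProduct.map (LinearMap.mul' K A ∘ₗ TensorProduct.map φ ψ) LinearMap.id
          ((TensorProduct.assoc K A A A).symm (iota13 (K := K) T * iota23 (K := K) U))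
        = TensorProduct.map φ LinearMap.id T * TensorProduct.map ψ LinearMap.id U := by
    induction T with
    | zero => simp
    | add x y hx hy => simp only [map_add, add_mul, hx, hy]
    | tmul a b =>
      induction U with
      | zero => simp
      | add x y hx hy => simp only [map_add, mul_add, hx, hy]
      | tmul c d => simp [iota13, iota23]
  rw [← key, ← hR, LinearEquiv.symm_apply_apply, ← LinearMap.comp_apply,
    ← TensorProduct.map_comp, LinearMap.comp_id, LinearMap.comp_assoc]

/-- The counit applied to the first leg of an invertible element satisfying the first hexagon
identity gives `1`. -/
theorem map_counit_id_eq_one {R : A ⊗[K] A} (hu : IsUnit R)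
    (hR : (TensorProduct.assoc K A A A)
        ((TensorProduct.map (Coalgebra.comul (R := K)) LinearMap.id) R)
      = iota13 (K := K) R * iota23 (K := K) R) :
    TensorProduct.map (Algebra.linearMap K A ∘ₗ Coalgebra.counit (R := K) (A := A))
      LinearMap.id R = 1 := by
  have hid : LinearMap.mul' K A ∘ₗ
      TensorProduct.map (Algebra.linearMap K A ∘ₗ Coalgebra.counit (R := K) (A := A))
          LinearMap.id ∘ₗ
        Coalgebra.comul (R := K) (A := A) = LinearMap.id := by
    have hmap : TensorProduct.map (Algebra.linearMap K A ∘ₗ Coalgebra.counit (R := K) (A := A))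
        (LinearMap.id : A →ₗ[K] A)
        = (Algebra.linearMap K A).rTensor A ∘ₗ (Coalgebra.counit (R := K)).rTensor A := by
      rw [← LinearMap.rTensor_comp]
      rfl
    rw [hmap, LinearMap.comp_assoc, Coalgebra.rTensor_counit_comp_comul]
    ext a
    simp
  have h := map_convolution_id_of_comul_eq hR
    (Algebra.linearMap K A ∘ₗ Coalgebra.counit (R := K) (A := A))
    LinearMap.id
  rw [hid, TensorProduct.map_id, LinearMap.id_apply] at h
  exact hu.mul_right_cancel (by rw [← h, one_mul])

/-- For a quasitriangular structure `𝓡` on a Hopf algebra `A` with antipode `S`, one has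
`(S ⊗ id)(𝓡) = 𝓡⁻¹` in `A ⊗ A`. -/
theorem antipode_tensor_id_R_matrix_eq_inv
    (R : A ⊗[K] A) (hR : IsQuasitriangular (K := K) R) :
    R * (TensorProduct.map (HopfAlgebra.antipode (R := K)) LinearMap.id) R = 1 ∧
    (TensorProduct.map (HopfAlgebra.antipode (R := K)) LinearMap.id) R * R = 1 := by
  obtain ⟨hu, -, hR, -⟩ := hR
  have hone := map_counit_id_eq_one hu hR
  constructor
  · have h := map_convolution_id_of_comul_eq hR LinearMap.id (HopfAlgebra.antipode K)
    rw [TensorProduct.map_id, LinearMap.id_apply] at h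
    rw [← h, ← hone, ← HopfAlgebra.mul_antipode_lTensor_comul]
    rfl
  · have h := map_convolution_id_of_comul_eq hR (HopfAlgebra.antipode K) LinearMap.id
    rw [TensorProduct.map_id, LinearMap.id_apply] at h
    rw [← h, ← hone, ← HopfAlgebra.mul_antipode_rTensor_comul]
    rfl

end
end

section
/- Let ħ, t ∈ ℂ with t, t+ħ, t+2ħ, t+3ħ all nonzero. Then the operators A(t)^{t₂} and A(t+2ħ) on V ⊗ V are invertible, and t(t+2ħ)·((A(t)^{t₂})⁻¹) = (t+ħ)(t+3ħ)·((A(t+2ħ)⁻¹)^{t₂}). (This is the matrix form of the crossing identity (R(t)^{t₂})⁻¹ = (R(t+2ħ)⁻¹)^{t₂} for the rational R-matrix, up to scalar normalization.) -/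
noncomputable section

/-- The flip operator `P` on `V ⊗ V`, `V = ℂ²`, in the standard basis `(eᵢ ⊗ eⱼ)`:
`P (eᵢ ⊗ eⱼ) = eⱼ ⊗ eᵢ`, i.e. `P_{(i,j),(k,l)} = δ_{i,l} δ_{j,k}`. -/
def flipP : Matrix (Fin 2 × Fin 2) (Fin 2 × Fin 2) ℂ :=
  fun p q => if p.1 = q.2 ∧ p.2 = q.1 then 1 else 0

/-- `A(z) = z·Id_{V⊗V} + hbar·P` on `V ⊗ V`. -/
def Amat (hbar z : ℂ) : Matrix (Fin 2 × Fin 2) (Fin 2 × Fin 2) ℂ :=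
  z • (1 : Matrix (Fin 2 × Fin 2) (Fin 2 × Fin 2) ℂ) + hbar • flipP

/-- The operator on `V^{⊗n}` (realized as matrices indexed by `Fin n → Fin 2`)
acting as the matrix `M` on the tensor factors `a` and `b` (in this order) and as the
identity on all remaining factors. -/
def emb (n : ℕ) (a b : Fin n) (M : Matrix (Fin 2 × Fin 2) (Fin 2 × Fin 2) ℂ) :
    Matrix (Fin n → Fin 2) (Fin n → Fin 2) ℂ :=
  fun f g => M (f a, f b) (g a, g b) *
    (if ∀ c, c ≠ a → c ≠ b → f c = g c then 1 else 0)

/-- The partial transpose in the second tensor factor: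
`(X^{t₂})_{(i,j),(k,l)} = X_{(i,l),(k,j)}`. -/
def ptranspose2 (X : Matrix (Fin 2 × Fin 2) (Fin 2 × Fin 2) ℂ) :
    Matrix (Fin 2 × Fin 2) (Fin 2 × Fin 2) ℂ :=
  fun p q => X (p.1, q.2) (q.1, p.2)

lemma flipP_mul_flipP : flipP * flipP = 1 := by
  ext ⟨i, j⟩ ⟨k, l⟩
  fin_cases i <;> fin_cases j <;> fin_cases k <;> fin_cases l <;>
    simp [flipP, Matrix.mul_apply, Fintype.sum_prod_type]

lemma ptranspose2_flipP_mul_self :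
    ptranspose2 flipP * ptranspose2 flipP = (2 : ℂ) • ptranspose2 flipP := by
  ext ⟨i, j⟩ ⟨k, l⟩
  fin_cases i <;> fin_cases j <;> fin_cases k <;> fin_cases l <;>
    norm_num [ptranspose2, flipP, Matrix.mul_apply, Fintype.sum_prod_type]

lemma ptranspose2_add (X Y : Matrix (Fin 2 × Fin 2) (Fin 2 × Fin 2) ℂ) :
    ptranspose2 (X + Y) = ptranspose2 X + ptranspose2 Y := rfl

lemma ptranspose2_smul (c : ℂ) (X : Matrix (Fin 2 × Fin 2) (Fin 2 × Fin 2) ℂ) :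
    ptranspose2 (c • X) = c • ptranspose2 X := rfl

lemma ptranspose2_one : ptranspose2 1 = 1 := by
  ext ⟨i, j⟩ ⟨k, l⟩
  simp [ptranspose2, Matrix.one_apply, eq_comm]

lemma ptranspose2_Amat (hbar z : ℂ) :
    ptranspose2 (Amat hbar z) = z • 1 + hbar • ptranspose2 flipP := by
  rw [Amat, ptranspose2_add, ptranspose2_smul, ptranspose2_smul, ptranspose2_one]

lemma Amat_mul_Amat_neg (hbar z : ℂ) :
    Amat hbar z * Amat (-hbar) z = ((z + hbar) * (z - hbar)) • 1 := by
  simp only [Amat, add_mul, mul_add, smul_mul_assoc, mul_smul_comm, one_mul, mul_one,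
    flipP_mul_flipP]
  module

lemma ptranspose2_Amat_mul (hbar t : ℂ) :
    ptranspose2 (Amat hbar t) * ptranspose2 (Amat (-hbar) (t + 2 * hbar)) =
      (t * (t + 2 * hbar)) • 1 := by
  simp only [ptranspose2_Amat, add_mul, mul_add, smul_mul_assoc, mul_smul_comm, one_mul, mul_one,
    ptranspose2_flipP_mul_self]
  module

lemma isUnit_and_smul_inv_eq {n : Type*} [Fintype n] [DecidableEq n] {X Y : Matrix n n ℂ} {c : ℂ}
    (hc : c ≠ 0) (h : X * Y = c • 1) : IsUnit X ∧ c • X⁻¹ = Y := by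
  have hXY : X * (c⁻¹ • Y) = 1 := by
    rw [mul_smul_comm, h, smul_smul, inv_mul_cancel₀ hc, one_smul]
  refine ⟨IsUnit.of_mul_eq_one _ hXY, ?_⟩
  rw [Matrix.inv_eq_right_inv hXY, smul_smul, mul_inv_cancel₀ hc, one_smul]

/-- Crossing identity for the rational R-matrix: for `t, t+ħ, t+2ħ, t+3ħ` nonzero,
`A(t)^{t₂}` and `A(t+2ħ)` are invertible and
`t(t+2ħ)·(A(t)^{t₂})⁻¹ = (t+ħ)(t+3ħ)·(A(t+2ħ)⁻¹)^{t₂}`. -/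
theorem rational_R_matrix_crossing (hbar t : ℂ)
    (h0 : t ≠ 0) (h1 : t + hbar ≠ 0) (h2 : t + 2 * hbar ≠ 0) (h3 : t + 3 * hbar ≠ 0) :
    IsUnit (ptranspose2 (Amat hbar t)) ∧ IsUnit (Amat hbar (t + 2 * hbar)) ∧
      (t * (t + 2 * hbar)) • (ptranspose2 (Amat hbar t))⁻¹
        = ((t + hbar) * (t + 3 * hbar)) • ptranspose2 ((Amat hbar (t + 2 * hbar))⁻¹) := by
  obtain ⟨hX, hXinv⟩ := isUnit_and_smul_inv_eq (mul_ne_zero h0 h2) (ptranspose2_Amat_mul hbar t)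
  have hmul : Amat hbar (t + 2 * hbar) * Amat (-hbar) (t + 2 * hbar) =
      ((t + hbar) * (t + 3 * hbar)) • 1 := by
    rw [Amat_mul_Amat_neg]
    congr 1
    ring
  obtain ⟨hA, hAinv⟩ := isUnit_and_smul_inv_eq (mul_ne_zero h1 h3) hmul
  exact ⟨hX, hA, by rw [hXinv, ← ptranspose2_smul, hAinv]⟩

end
end

section
/- Let n ≥ 2, let ħ, η ∈ ℂ, and let z = (z₁,…,zₙ) ∈ ℂⁿ be such that z_a − z_b + cη ≠ −ħ for all a ≠ b and all c ∈ {−1, 0, 1}. For 1 ≤ i ≤ n define the qKZ operator K_i(z) = R⁽ⁱ'ⁱ⁻¹⁾(z_i−z_{i−1}+η) ⋯ R⁽ⁱ'¹⁾(z_i−z_1+η) · R⁽ⁱ'ⁿ⁾(z_i−z_n) ⋯ R⁽ⁱ'ⁱ⁺¹⁾(z_i−z_{i+1}) acting on V^{⊗n}. Then these operators form a compatible (flat) difference system of step η: for all i ≠ j, K_j(z + ηδ_i) ∘ K_i(z) = K_i(z + ηδ_j) ∘ K_j(z), where δ_i is the i-th standard basis vector of ℂⁿ. -/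
noncomputable section

/-- The normalized rational R-matrix `R(z) = (z·Id + ħ·P)/(z + ħ)`. -/
def Rmat (hbar z : ℂ) : Matrix (Fin 2 × Fin 2) (Fin 2 × Fin 2) ℂ :=
  (z + hbar)⁻¹ • Amat hbar z

/-- The qKZ operator
`K_i(z) = R⁽ⁱ'ⁱ⁻¹⁾(z_i−z_{i−1}+η) ⋯ R⁽ⁱ'¹⁾(z_i−z_1+η) · R⁽ⁱ'ⁿ⁾(z_i−z_n) ⋯ R⁽ⁱ'ⁱ⁺¹⁾(z_i−z_{i+1})`
acting on `V^{⊗n}`. -/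
def Kop (n : ℕ) (hbar η : ℂ) (z : Fin n → ℂ) (i : Fin n) :
    Matrix (Fin n → Fin 2) (Fin n → Fin 2) ℂ :=
  ((((List.finRange n).filter (fun j => j < i)).reverse.map
      (fun j => emb n i j (Rmat hbar (z i - z j + η)))).prod) *
  ((((List.finRange n).filter (fun j => i < j)).reverse.map
      (fun j => emb n i j (Rmat hbar (z i - z j)))).prod)

/-- The operator on `V^{⊗n}` permuting the tensor factors by `σ`. -/
def permOp (n : ℕ) (σ : Equiv.Perm (Fin n)) :
    Matrix (Fin n → Fin 2) (Fin n → Fin 2) ℂ :=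
  fun f g => if f ∘ σ = g then 1 else 0

theorem permOp_one (n : ℕ) : permOp n 1 = 1 := by
  ext f g
  simp [permOp, Matrix.one_apply]

theorem permOp_mul (n : ℕ) (σ τ : Equiv.Perm (Fin n)) :
    permOp n σ * permOp n τ = permOp n (σ * τ) := by
  ext f g
  simp only [permOp, Matrix.mul_apply, ite_mul, one_mul, zero_mul]
  rw [Finset.sum_ite_eq]
  simp only [Finset.mem_univ, if_true, Equiv.Perm.coe_mul, Function.comp_assoc]
  congr

theorem emb_flipP {n : ℕ} {a b : Fin n} (hab : a ≠ b) :
    emb n a b flipP = permOp n (Equiv.swap a b) := by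
  ext f g
  have key : f ∘ Equiv.swap a b = g ↔
      (f a = g b ∧ f b = g a) ∧ ∀ c, c ≠ a → c ≠ b → f c = g c := by
    constructor
    · rintro rfl
      refine ⟨by simp, fun c hca hcb => ?_⟩
      simp [Equiv.swap_apply_of_ne_of_ne hca hcb]
    · rintro ⟨⟨h₁, h₂⟩, h⟩
      funext c
      by_cases hca : c = a
      · subst hca; simpa using h₂
      by_cases hcb : c = b
      · subst hcb; simpa using h₁
      simpa [Equiv.swap_apply_of_ne_of_ne hca hcb] using h c hca hcb
  simp only [emb, flipP, permOp, key, ite_and]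
  split_ifs <;> simp

theorem emb_one {n : ℕ} (a b : Fin n) : emb n a b 1 = 1 := by
  ext f g
  have key : f = g ↔ (f a, f b) = (g a, g b) ∧ ∀ c, c ≠ a → c ≠ b → f c = g c := by
    constructor
    · rintro rfl
      simp
    · rintro ⟨h₁, h⟩
      simp only [Prod.mk.injEq] at h₁
      funext c
      by_cases hca : c = a
      · subst hca; exact h₁.1
      by_cases hcb : c = b
      · subst hcb; exact h₁.2
      exact h c hca hcb
  simp only [emb, Matrix.one_apply, key, ite_and]
  split_ifs <;> simp

theorem emb_Rmat {n : ℕ} {a b : Fin n} (hab : a ≠ b) (hbar u : ℂ) :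
    emb n a b (Rmat hbar u) =
      (u + hbar)⁻¹ • (u • (1 : Matrix (Fin n → Fin 2) (Fin n → Fin 2) ℂ) +
        hbar • permOp n (Equiv.swap a b)) := by
  rw [← emb_flipP hab, ← emb_one a b]
  ext f g
  simp only [emb, Rmat, Amat, Matrix.smul_apply, Matrix.add_apply, smul_eq_mul]
  ring

theorem emb_Rmat_unitarity {n : ℕ} {a b : Fin n} (hab : a ≠ b) {hbar u v : ℂ}
    (huv : u + v = 0) (hu : u ≠ -hbar) (hv : v ≠ -hbar) :
    emb n a b (Rmat hbar u) * emb n b a (Rmat hbar v) = 1 := by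
  obtain rfl : v = -u := by linear_combination huv
  rw [emb_Rmat hab, emb_Rmat hab.symm, Equiv.swap_comm b a]
  have hS : permOp n (Equiv.swap a b) * permOp n (Equiv.swap a b) = 1 := by
    rw [permOp_mul, Equiv.swap_mul_self, permOp_one]
  have hu' : u + hbar ≠ 0 := fun h => hu (by linear_combination h)
  have hv' : -u + hbar ≠ 0 := fun h => hv (by linear_combination h)
  simp only [smul_mul_smul_comm, add_mul, mul_add, hS, mul_one, one_mul, smul_add, smul_smul]
  match_scalars
  · field_simp
    ring
  · ring

theorem emb_Rmat_yangBaxter {n : ℕ} {a b c : Fin n} (hab : a ≠ b) (hac : a ≠ c) (hbc : b ≠ c)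
    (hbar : ℂ) {u v w : ℂ} (h : v = u + w) :
    emb n a b (Rmat hbar u) * emb n a c (Rmat hbar v) * emb n b c (Rmat hbar w) =
      emb n b c (Rmat hbar w) * emb n a c (Rmat hbar v) * emb n a b (Rmat hbar u) := by
  subst h
  rw [emb_Rmat hab, emb_Rmat hac, emb_Rmat hbc]
  set A := permOp n (Equiv.swap a b) with hA
  set B := permOp n (Equiv.swap b c) with hB
  set C := permOp n (Equiv.swap a c) with hC
  have hAC : A * C = B * A := by
    rw [hA, hB, hC, permOp_mul, permOp_mul, Equiv.mul_swap_eq_swap_mul, Equiv.swap_apply_left,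
      Equiv.swap_apply_of_ne_of_ne hac.symm hbc.symm]
  have hCB : C * B = B * A := by
    rw [← hAC, hA, hB, hC, permOp_mul, permOp_mul, Equiv.mul_swap_eq_swap_mul,
      Equiv.swap_apply_right, Equiv.swap_apply_of_ne_of_ne hab.symm hbc, Equiv.swap_comm b a]
  have hCA : C * A = A * B := by
    rw [hA, hB, hC, permOp_mul, permOp_mul, Equiv.mul_swap_eq_swap_mul _ b c,
      Equiv.swap_apply_right, Equiv.swap_apply_of_ne_of_ne hac.symm hbc.symm]
  have hBC : B * C = A * B := by
    rw [← hCA, hA, hB, hC, permOp_mul, permOp_mul, Equiv.mul_swap_eq_swap_mul _ a b,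
      Equiv.swap_apply_left, Equiv.swap_apply_of_ne_of_ne hab.symm hbc, Equiv.swap_comm c b]
  have hABA : A * (B * A) = B * (A * B) := by rw [← hCA, ← mul_assoc, ← mul_assoc, hBC]
  simp only [add_mul, mul_add, mul_one, one_mul, smul_add, smul_smul, smul_mul_assoc, mul_smul_comm, hAC, hCB, hCA, hBC, hABA,
    mul_assoc]
  match_scalars <;> ring

theorem emb_Rmat_commute {n : ℕ} {a b c d : Fin n} (hab : a ≠ b) (hcd : c ≠ d)
    (hac : a ≠ c) (had : a ≠ d) (hbc : b ≠ c) (hbd : b ≠ d) (hbar u v : ℂ) :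
    Commute (emb n a b (Rmat hbar u)) (emb n c d (Rmat hbar v)) := by
  have hS : Commute (permOp n (Equiv.swap a b)) (permOp n (Equiv.swap c d)) := by
    rw [Commute, SemiconjBy, permOp_mul, permOp_mul, Equiv.mul_swap_eq_swap_mul,
      Equiv.swap_apply_of_ne_of_ne hac.symm hbc.symm,
      Equiv.swap_apply_of_ne_of_ne had.symm hbd.symm]
  rw [emb_Rmat hab, emb_Rmat hcd]
  refine Commute.smul_left (Commute.smul_right ?_ _) _
  exact .add_left (.smul_left (.one_left _) _)
    (.add_right (.smul_right (.one_right _) _) (.smul_left (.smul_right hS _) _))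

theorem commute_map_prod {M ι : Type*} [Monoid M] {L L' : List ι} {F G : ι → M}
    (h : ∀ k ∈ L, ∀ l ∈ L', Commute (F k) (G l)) :
    Commute (L.map F).prod (L'.map G).prod := by
  refine Commute.list_prod_left _ _ fun x hx => Commute.list_prod_right _ _ fun y hy => ?_
  obtain ⟨k, hk, rfl⟩ := List.mem_map.1 hx
  obtain ⟨l, hl, rfl⟩ := List.mem_map.1 hy
  exact h k hk l hl

/-- The train argument: an element exchanging each pair `F k`, `G k` exchanges the ordered
products of these. -/
theorem mul_map_prod_mul_map_prod {M ι : Type*} [Monoid M] (X : M) (F G : ι → M) {L : List ι}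
    (hL : L.Nodup) (hX : ∀ k ∈ L, X * F k * G k = G k * F k * X)
    (hFG : ∀ k ∈ L, ∀ l ∈ L, k ≠ l → Commute (F k) (G l)) :
    X * (L.map F).prod * (L.map G).prod = (L.map G).prod * (L.map F).prod * X := by
  induction L with
  | nil => simp
  | cons k L ih =>
    rw [List.nodup_cons] at hL
    have hne : ∀ l ∈ L, k ≠ l := fun l hl h => hL.1 (h ▸ hl)
    have ih' := ih hL.2 (fun l hl => hX l (List.mem_cons_of_mem _ hl))
      (fun l hl m hm => hFG l (List.mem_cons_of_mem _ hl) m (List.mem_cons_of_mem _ hm))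
    have h₁ : Commute (L.map F).prod (G k) := by
      simpa using commute_map_prod (L' := [k]) (F := F) (G := G) (L := L) (by
        simpa using fun l hl => hFG l (by simp [hl]) k (by simp) (hne l hl).symm)
    have h₂ : Commute (F k) (L.map G).prod := by
      simpa using commute_map_prod (L := [k]) (F := F) (G := G) (L' := L) (by
        simpa using fun l hl => hFG k (by simp) l (by simp [hl]) (hne l hl))
    simp only [List.map_cons, List.prod_cons]
    calc X * (F k * (L.map F).prod) * (G k * (L.map G).prod)
        = X * F k * ((L.map F).prod * G k) * (L.map G).prod := by simp only [mul_assoc]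
      _ = (X * F k * G k) * (L.map F).prod * (L.map G).prod := by
        rw [h₁.eq]; simp only [mul_assoc]
      _ = G k * F k * (X * (L.map F).prod * (L.map G).prod) := by
        rw [hX k (by simp)]; simp only [mul_assoc]
      _ = G k * (F k * (L.map G).prod) * (L.map F).prod * X := by
        rw [ih']; simp only [mul_assoc]
      _ = _ := by rw [h₂.eq]; simp only [mul_assoc]

theorem filter_lt_finRange {n : ℕ} {i j : Fin n} (hij : i < j) :
    (List.finRange n).filter (fun k => k < j) =
      (List.finRange n).filter (fun k => k < i) ++
        i :: (List.finRange n).filter (fun k => i < k ∧ k < j) := by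
  refine List.Pairwise.eq_of_mem_iff (r := (· < ·)) ?_ ?_ fun k => ?_
  · exact (List.pairwise_lt_finRange n).filter _
  · simp only [List.pairwise_append, List.pairwise_cons, List.mem_filter, List.mem_cons,
      List.mem_finRange, decide_eq_true_eq, true_and]
    refine ⟨(List.pairwise_lt_finRange n).filter _,
      ⟨fun _ h => h.1, (List.pairwise_lt_finRange n).filter _⟩, ?_⟩
    rintro a ha b (rfl | hb)
    exacts [ha, ha.trans hb.1]
  · simp
    omega

theorem filter_gt_finRange {n : ℕ} {i j : Fin n} (hij : i < j) :
    (List.finRange n).filter (fun k => i < k) =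
      (List.finRange n).filter (fun k => i < k ∧ k < j) ++
        j :: (List.finRange n).filter (fun k => j < k) := by
  refine List.Pairwise.eq_of_mem_iff (r := (· < ·)) ?_ ?_ fun k => ?_
  · exact (List.pairwise_lt_finRange n).filter _
  · simp only [List.pairwise_append, List.pairwise_cons, List.mem_filter, List.mem_cons,
      List.mem_finRange, decide_eq_true_eq, true_and]
    refine ⟨(List.pairwise_lt_finRange n).filter _,
      ⟨fun _ h => h, (List.pairwise_lt_finRange n).filter _⟩, ?_⟩
    rintro a ha b (rfl | hb)
    exacts [ha.2, ha.2.trans hb]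
  · simp
    omega

/-- The ordered product of the R-matrices `R⁽ᵃᵏ⁾(u − z_k)` over `k` in the reversed list `L`. -/
def rowOp (n : ℕ) (hbar : ℂ) (z : Fin n → ℂ) (a : Fin n) (u : ℂ) (L : List (Fin n)) :
    Matrix (Fin n → Fin 2) (Fin n → Fin 2) ℂ :=
  (L.reverse.map fun k => emb n a k (Rmat hbar (u - z k))).prod

theorem rowOp_append_cons {n : ℕ} (hbar : ℂ) (z : Fin n → ℂ) (a b : Fin n) (u : ℂ)
    (L L' : List (Fin n)) :
    rowOp n hbar z a u (L ++ b :: L') =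
      rowOp n hbar z a u L' * emb n a b (Rmat hbar (u - z b)) * rowOp n hbar z a u L := by
  simp [rowOp, mul_assoc]

theorem rowOp_congr {n : ℕ} (hbar : ℂ) {z z' : Fin n → ℂ} (a : Fin n) (u : ℂ)
    {L : List (Fin n)} (h : ∀ k ∈ L, z' k = z k) :
    rowOp n hbar z' a u L = rowOp n hbar z a u L := by
  unfold rowOp
  congr 1
  exact List.map_congr_left fun k hk => by rw [h k (List.mem_reverse.1 hk)]

theorem Kop_eq_rowOp (n : ℕ) (hbar η : ℂ) (z : Fin n → ℂ) (i : Fin n) :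
    Kop n hbar η z i =
      rowOp n hbar z i (z i + η) ((List.finRange n).filter fun k => k < i) *
        rowOp n hbar z i (z i) ((List.finRange n).filter fun k => i < k) := by
  simp only [Kop, rowOp, sub_add_eq_add_sub]

theorem rowOp_commute {n : ℕ} (hbar : ℂ) (z : Fin n → ℂ) {a b : Fin n} (hab : a ≠ b) (u v : ℂ)
    {L L' : List (Fin n)} (haL : a ∉ L) (haL' : a ∉ L') (hbL : b ∉ L) (hbL' : b ∉ L')
    (hd : L.Disjoint L') :
    Commute (rowOp n hbar z a u L) (rowOp n hbar z b v L') := by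
  refine commute_map_prod fun k hk l hl => ?_
  rw [List.mem_reverse] at hk hl
  exact emb_Rmat_commute (ne_of_mem_of_not_mem hk haL).symm (ne_of_mem_of_not_mem hl hbL').symm
    hab (ne_of_mem_of_not_mem hl haL').symm (ne_of_mem_of_not_mem hk hbL)
    (fun h => hd hk (h ▸ hl)) _ _ _

theorem emb_Rmat_mul_rowOp_mul_rowOp {n : ℕ} (hbar : ℂ) (z : Fin n → ℂ) {a b : Fin n}
    (hab : a ≠ b) {u v w : ℂ} (hw : w = u - v) {L : List (Fin n)} (hL : L.Nodup)
    (haL : a ∉ L) (hbL : b ∉ L) :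
    emb n a b (Rmat hbar w) * rowOp n hbar z a u L * rowOp n hbar z b v L =
      rowOp n hbar z b v L * rowOp n hbar z a u L * emb n a b (Rmat hbar w) := by
  refine mul_map_prod_mul_map_prod _ _ _ (List.nodup_reverse.2 hL) (fun k hk => ?_)
    fun k hk l hl hkl => ?_
  · rw [List.mem_reverse] at hk
    exact emb_Rmat_yangBaxter hab (ne_of_mem_of_not_mem hk haL).symm
      (ne_of_mem_of_not_mem hk hbL).symm _ (by rw [hw]; ring)
  · rw [List.mem_reverse] at hk hl
    exact emb_Rmat_commute (ne_of_mem_of_not_mem hk haL).symm (ne_of_mem_of_not_mem hl hbL).symm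
      hab (ne_of_mem_of_not_mem hl haL).symm (ne_of_mem_of_not_mem hk hbL) hkl _ _ _

/-- Compatibility of the qKZ operators for `i < j`. -/
theorem Kop_compatibility_of_lt {n : ℕ} {hbar η : ℂ} {z : Fin n → ℂ}
    (hz : ∀ a b : Fin n, a ≠ b → ∀ c : ℂ, (c = -1 ∨ c = 0 ∨ c = 1) →
      z a - z b + c * η ≠ -hbar)
    {i j : Fin n} (hij : i < j) :
    Kop n hbar η (fun a => z a + if a = i then η else 0) j * Kop n hbar η z i
      = Kop n hbar η (fun a => z a + if a = j then η else 0) i * Kop n hbar η z j := by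
  have hne := hij.ne
  simp only [Kop_eq_rowOp, filter_lt_finRange hij, filter_gt_finRange hij, rowOp_append_cons,
    if_pos, if_neg hne, if_neg hne.symm, add_zero]
  set lo := (List.finRange n).filter fun k => k < i
  set mid := (List.finRange n).filter fun k => i < k ∧ k < j
  set hi := (List.finRange n).filter fun k => j < k
  have hnd (p : Fin n → Bool) : ((List.finRange n).filter p).Nodup :=
    (List.nodup_finRange n).filter _
  have ilo : i ∉ lo := by simp [lo]
  have jlo : j ∉ lo := by simp [lo, hij.le]
  have imid : i ∉ mid := by simp [mid]
  have jmid : j ∉ mid := by simp [mid]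
  have ihi : i ∉ hi := by simp [hi, hij.le]
  have jhi : j ∉ hi := by simp [hi]
  have dlm : lo.Disjoint mid := by
    intro k; simp only [lo, mid, List.mem_filter, decide_eq_true_eq]; omega
  have dlh : lo.Disjoint hi := by
    intro k; simp only [lo, hi, List.mem_filter, decide_eq_true_eq]; omega
  have dmh : mid.Disjoint hi := by
    intro k; simp only [mid, hi, List.mem_filter, decide_eq_true_eq]; omega
  have shift {m : Fin n} {L : List (Fin n)} (hm : m ∉ L) (a : Fin n) (u : ℂ) :
      rowOp n hbar (fun a => z a + if a = m then η else 0) a u L = rowOp n hbar z a u L :=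
    rowOp_congr hbar a u fun k hk => by simp [ne_of_mem_of_not_mem hk hm]
  simp only [shift ilo, shift jlo, shift imid, shift jmid, shift ihi, shift jhi]
  have e₁ : z j + η - (z i + η) = z j - z i := by ring
  rw [e₁]
  have unit₁ : emb n j i (Rmat hbar (z j - z i)) * emb n i j (Rmat hbar (z i - z j)) = 1 :=
    emb_Rmat_unitarity hne.symm (by ring) (by simpa using hz j i hne.symm 0 (by simp))
      (by simpa using hz i j hne 0 (by simp))
  have unit₂ : emb n i j (Rmat hbar (z i - (z j + η))) *
      emb n j i (Rmat hbar (z j + η - z i)) = 1 := by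
    refine emb_Rmat_unitarity hne (by ring) (fun h => hz i j hne (-1) (by simp) ?_)
      fun h => hz j i hne.symm 1 (by simp) ?_
    · rw [← h]; ring
    · rw [← h]; ring
  have xlo := emb_Rmat_mul_rowOp_mul_rowOp hbar z hne.symm (u := z j + η) (v := z i + η)
    (w := z j - z i) (by ring) (hnd _) jlo ilo
  have xhi := emb_Rmat_mul_rowOp_mul_rowOp hbar z hne.symm (u := z j) (v := z i)
    (w := z j - z i) rfl (hnd _) jhi ihi
  have xmid := emb_Rmat_mul_rowOp_mul_rowOp hbar z hne (u := z i) (v := z j + η)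
    (w := z i - (z j + η)) rfl (hnd _) imid jmid
  have c₁ := rowOp_commute hbar z hne (z i + η) (z j) ilo ihi jlo jhi dlh
  have c₂ := rowOp_commute hbar z hne.symm (z j + η) (z i) jlo jhi ilo ihi dlh
  have c₃ := rowOp_commute hbar z hne (z i + η) (z j + η) ilo imid jlo jmid dlm
  have c₄ := rowOp_commute hbar z hne (z i) (z j + η) ihi imid jhi jmid dmh.symm
  have c₅ := rowOp_commute hbar z hne (z i) (z j + η) imid ilo jmid jlo dlm.symm
  have c₆ := rowOp_commute hbar z hne (z i) (z j) imid ihi jmid jhi dmh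
  generalize rowOp n hbar z i (z i + η) lo = Il at *
  generalize rowOp n hbar z i (z i) mid = Im at *
  generalize rowOp n hbar z i (z i) hi = Ih at *
  generalize rowOp n hbar z j (z j + η) lo = Jl at *
  generalize rowOp n hbar z j (z j + η) mid = Jm at *
  generalize rowOp n hbar z j (z j) hi = Jh at *
  generalize emb n j i (Rmat hbar (z j - z i)) = X at *
  generalize emb n i j (Rmat hbar (z i - z j)) = X' at *
  generalize emb n i j (Rmat hbar (z i - (z j + η))) = Y at *
  generalize emb n j i (Rmat hbar (z j + η - z i)) = Y' at *
  calc Jm * X * Jl * Jh * (Il * (Ih * X' * Im))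
      = Jm * (X * Jl * (Jh * Il) * Ih) * X' * Im := by simp only [mul_assoc]
    _ = Jm * ((X * Jl * Il) * Jh * Ih) * X' * Im := by rw [← c₁.eq]; simp only [mul_assoc]
    _ = Jm * (Il * Jl * (X * Jh * Ih)) * X' * Im := by rw [xlo]; simp only [mul_assoc]
    _ = Jm * (Il * (Jl * Ih) * Jh) * (X * X') * Im := by rw [xhi]; simp only [mul_assoc]
    _ = (Jm * Il) * Ih * Jl * (Jh * Im) := by
      rw [unit₁, c₂.eq, mul_one]; simp only [mul_assoc]
    _ = Il * (Jm * Ih) * (Jl * Im) * Jh := by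
      rw [← c₃.eq, ← c₆.eq]; simp only [mul_assoc]
    _ = Il * Ih * (Jm * Im * (Y * Y')) * Jl * Jh := by
      rw [← c₄.eq, ← c₅.eq, unit₂, mul_one]; simp only [mul_assoc]
    _ = Il * Ih * (Jm * Im * Y) * Y' * Jl * Jh := by simp only [mul_assoc]
    _ = _ := by rw [← xmid]; simp only [mul_assoc]

/-- The qKZ operators form a compatible (flat) difference system of step `η`:
`K_j(z + ηδ_i) ∘ K_i(z) = K_i(z + ηδ_j) ∘ K_j(z)` for `i ≠ j`, provided
`z_a − z_b + cη ≠ −ħ` for all `a ≠ b` and `c ∈ {−1, 0, 1}`. -/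
theorem qKZ_compatibility (n : ℕ) (hn : 2 ≤ n) (hbar η : ℂ) (z : Fin n → ℂ)
    (hz : ∀ a b : Fin n, a ≠ b → ∀ c : ℂ, (c = -1 ∨ c = 0 ∨ c = 1) →
      z a - z b + c * η ≠ -hbar)
    (i j : Fin n) (hij : i ≠ j) :
    Kop n hbar η (fun a => z a + if a = i then η else 0) j * Kop n hbar η z i
      = Kop n hbar η (fun a => z a + if a = j then η else 0) i * Kop n hbar η z j := by
  rcases hij.lt_or_gt with h | h
  · exact Kop_compatibility_of_lt hz h
  · exact (Kop_compatibility_of_lt hz h).symm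

end
end

section
/- Let f be a nonzero rational function in ℂ(X) whose numerator and denominator (in lowest terms) satisfy deg(numerator) + 2 ≤ deg(denominator), i.e. f vanishes at infinity to order at least 2. Then res_a(f) = 0 for all but finitely many a ∈ ℂ, and the total sum of residues vanishes: Σ_{a ∈ ℂ} res_a(f) = 0. -/
noncomputable section

/-- The residue of a rational function `f ∈ ℂ(X)` at a point `a ∈ ℂ`: the coefficient of
`X^{−1}` in the formal Laurent expansion of `f(X + a)`, i.e. of the image of `f` under
the automorphism `X ↦ X + a` of `ℂ(X)`, embedded into `ℂ((X))`. -/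
def resAt (a : ℂ) (f : RatFunc ℂ) : ℂ :=
  ((RatFunc.laurent a f : RatFunc ℂ) : LaurentSeries ℂ).coeff (-1)

open Polynomial LaurentSeries

theorem RatFunc.coe_C_eq_hahnSeries_C {F : Type*} [Field F] (c : F) :
    ((RatFunc.C c : RatFunc F) : LaurentSeries F) = HahnSeries.C c := by
  rw [← RatFunc.algebraMap_C, ← IsScalarTower.algebraMap_apply F[X] (RatFunc F) F⸨X⸩,
    Polynomial.algebraMap_hahnSeries_apply, Polynomial.coe_C, HahnSeries.ofPowerSeries_C]

theorem resAt_add (a : ℂ) (f g : RatFunc ℂ) : resAt a (f + g) = resAt a f + resAt a g := by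
  simp [resAt]

theorem resAt_C_mul (a c : ℂ) (f : RatFunc ℂ) :
    resAt a (RatFunc.C c * f) = c * resAt a f := by
  simp [resAt, RatFunc.coe_C_eq_hahnSeries_C]

theorem resAt_div (a : ℂ) (p q : ℂ[X]) :
    resAt a (algebraMap _ _ p / algebraMap _ _ q) =
      (HahnSeries.ofPowerSeries ℤ ℂ (taylor a p : ℂ[X]) /
        HahnSeries.ofPowerSeries ℤ ℂ (taylor a q : ℂ[X])).coeff (-1) := by
  rw [resAt, RatFunc.laurent_div, RatFunc.algebraMap_apply_div,
    Polynomial.algebraMap_hahnSeries_apply, Polynomial.algebraMap_hahnSeries_apply]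

/-- A rational function that is regular at `a` has no residue there. -/
theorem resAt_div_eq_zero {a : ℂ} (p : ℂ[X]) {q : ℂ[X]} (hq : q.eval a ≠ 0) :
    resAt a (algebraMap _ _ p / algebraMap _ _ q) = 0 := by
  have h0 : PowerSeries.constantCoeff ((taylor a q : ℂ[X]) : PowerSeries ℂ) ≠ 0 := by
    simpa using hq
  have hne : HahnSeries.ofPowerSeries ℤ ℂ (taylor a q : ℂ[X]) ≠ 0 := by
    intro h
    rw [map_eq_zero_iff _ HahnSeries.ofPowerSeries_injective] at h
    simp [h] at h0
  have key : HahnSeries.ofPowerSeries ℤ ℂ (taylor a p : ℂ[X]) /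
      HahnSeries.ofPowerSeries ℤ ℂ (taylor a q : ℂ[X]) =
      HahnSeries.ofPowerSeries ℤ ℂ ((taylor a p : ℂ[X]) *
        ((taylor a q : ℂ[X]) : PowerSeries ℂ)⁻¹) := by
    rw [div_eq_iff hne, ← map_mul, mul_assoc, PowerSeries.inv_mul_cancel _ h0, mul_one]
  rw [resAt_div, key, PowerSeries.coeff_coe]
  simp

theorem resAt_div_X_sub_C_pow (b : ℂ) (n : ℕ) (p : ℂ[X]) :
    resAt b (algebraMap _ _ p / algebraMap _ _ ((X - C b) ^ (n + 1))) =
      (taylor b p).coeff n := by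
  have hT : taylor b ((X - C b) ^ (n + 1)) = X ^ (n + 1) := by
    simp [taylor_pow, map_sub, taylor_X, taylor_C]
  rw [resAt_div, hT, Polynomial.coe_pow, Polynomial.coe_X, HahnSeries.ofPowerSeries_X_pow,
    div_eq_mul_inv, HahnSeries.inv_single, inv_one]
  have h : (-1 : ℤ) = n + -((n + 1 : ℕ) : ℤ) := by push_cast; ring
  rw [h, HahnSeries.coeff_mul_single_add, mul_one, HahnSeries.ofPowerSeries_apply_coeff,
    Polynomial.coeff_coe]

/-- The rational function `f` has finitely many nonzero residues, and they add up to `c`. -/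
def HasResidueSum (f : RatFunc ℂ) (c : ℂ) : Prop :=
  {a : ℂ | resAt a f ≠ 0}.Finite ∧ ∑ᶠ a : ℂ, resAt a f = c

theorem HasResidueSum.add {f g : RatFunc ℂ} {c d : ℂ} (hf : HasResidueSum f c)
    (hg : HasResidueSum g d) : HasResidueSum (f + g) (c + d) := by
  refine ⟨(hf.1.union hg.1).subset fun a ha => ?_, ?_⟩
  · by_contra h
    simp only [Set.mem_union, Set.mem_ofPred_eq, not_or, not_not] at h
    exact ha (by rw [resAt_add, h.1, h.2, add_zero])
  · simp_rw [resAt_add]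
    rw [finsum_add_distrib hf.1 hg.1, hf.2, hg.2]

theorem HasResidueSum.C_mul {f : RatFunc ℂ} {c : ℂ} (hf : HasResidueSum f c) (r : ℂ) :
    HasResidueSum (RatFunc.C r * f) (r * c) := by
  refine ⟨hf.1.subset fun a ha h => ha (by rw [resAt_C_mul, h, mul_zero]), ?_⟩
  simp_rw [resAt_C_mul]
  rw [← mul_finsum, hf.2]

theorem hasResidueSum_div_X_sub_C_pow (b : ℂ) (n : ℕ) {p : ℂ[X]} (hp : p.natDegree ≤ n) :
    HasResidueSum (algebraMap _ _ p / algebraMap _ _ ((X - C b) ^ (n + 1))) (p.coeff n) := by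
  have h0 : ∀ a, a ≠ b →
      resAt a (algebraMap _ _ p / algebraMap _ _ ((X - C b) ^ (n + 1))) = 0 := fun a ha =>
    resAt_div_eq_zero p (by simp [sub_eq_zero, ha])
  refine ⟨(Set.finite_singleton b).subset fun a ha => by_contra fun h => ha (h0 a h), ?_⟩
  rw [finsum_eq_single _ b h0, resAt_div_X_sub_C_pow]
  rcases hp.lt_or_eq with h | rfl
  · rw [coeff_eq_zero_of_natDegree_lt h, coeff_eq_zero_of_natDegree_lt (by simpa using h)]
  · rw [coeff_taylor_natDegree, leadingCoeff]

/-- If `q` is monic of degree `n + 1` and `p` has degree at most `n`, then the residues of `p / q`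
add up to the coefficient of `X ^ n` in `p`. Here `q` is given by the multiset of its roots. -/
theorem hasResidueSum_div_prod (n : ℕ) : ∀ (s : Multiset ℂ) (p : ℂ[X]), s.card = n + 1 →
    p.natDegree ≤ n → HasResidueSum
      (algebraMap _ _ p / algebraMap _ _ (s.map fun a => X - C a).prod) (p.coeff n) := by
  induction n with
  | zero =>
    intro s p hs hp
    obtain ⟨b, rfl⟩ := Multiset.card_eq_one.1 hs
    simpa using hasResidueSum_div_X_sub_C_pow b 0 hp
  | succ n ih =>
    intro s p hs hp
    obtain ⟨b, hb⟩ := Multiset.card_pos_iff_exists_mem.1 (by omega : 0 < s.card)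
    obtain ⟨t, rfl⟩ := Multiset.exists_cons_of_mem hb
    by_cases hall : ∀ x ∈ b ::ₘ t, x = b
    · rw [Multiset.eq_replicate.2 ⟨hs, hall⟩, Multiset.map_replicate, Multiset.prod_replicate]
      exact hasResidueSum_div_X_sub_C_pow b (n + 1) hp
    push Not at hall
    obtain ⟨a, hat, hab⟩ := hall
    obtain ⟨u, rfl⟩ := Multiset.exists_cons_of_mem
      ((Multiset.mem_cons.1 hat).resolve_left hab)
    simp only [Multiset.card_cons, Nat.add_right_cancel_iff] at hs
    set p' := p /ₘ (X - C a) with hp'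
    set d := p.eval a
    have hdiv : p = C d + (X - C a) * p' := by
      rw [← modByMonic_X_sub_C_eq_C_eval, modByMonic_add_div]
    have hdeg : p'.natDegree ≤ n := by
      rw [hp', natDegree_divByMonic _ (monic_X_sub_C a), natDegree_X_sub_C]
      omega
    have hcoeff : p.coeff (n + 1) = p'.coeff n := by
      rw [hdiv, coeff_add, coeff_C_succ, zero_add, sub_mul, coeff_sub, coeff_X_mul, coeff_C_mul,
        coeff_eq_zero_of_natDegree_lt (Nat.lt_succ_of_le hdeg), mul_zero, sub_zero]
    have hA := ih (b ::ₘ u) p' (by simp [hs]) hdeg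
    have hB := ih (b ::ₘ u) (C d) (by simp [hs]) (by simp)
    have hC := ih (a ::ₘ u) (C d) (by simp [hs]) (by simp)
    have hsum := hA.add ((hC.C_mul (a - b)⁻¹).add (hB.C_mul (-(a - b)⁻¹)))
    have hval : p.coeff (n + 1) = p'.coeff n +
        ((a - b)⁻¹ * (C d).coeff n + -(a - b)⁻¹ * (C d).coeff n) := by
      rw [hcoeff]; ring
    rw [hval]
    convert hsum using 1
    have hne : ∀ x : ℂ, algebraMap ℂ[X] (RatFunc ℂ) (X - C x) ≠ 0 := fun x =>
      RatFunc.algebraMap_ne_zero (X_sub_C_ne_zero x)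
    have hu : algebraMap ℂ[X] (RatFunc ℂ) (u.map fun a => X - C a).prod ≠ 0 :=
      RatFunc.algebraMap_ne_zero
        (monic_multiset_prod_of_monic _ _ fun x _ => monic_X_sub_C x).ne_zero
    have hr : algebraMap ℂ[X] (RatFunc ℂ) (X - C b) - algebraMap ℂ[X] (RatFunc ℂ) (X - C a) =
        RatFunc.C (a - b) := by
      rw [← map_sub, ← RatFunc.algebraMap_C]
      congr 1
      rw [C_sub]; ring
    have hr0 : RatFunc.C (a - b) ≠ 0 := by
      rwa [Ne, map_eq_zero, sub_eq_zero]
    simp only [Multiset.map_cons, Multiset.prod_cons]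
    rw [hdiv]
    simp only [map_mul, map_add, map_neg, map_inv₀]
    have ha := hne a
    have hb := hne b
    rw [← hr] at hr0 ⊢
    generalize algebraMap ℂ[X] (RatFunc ℂ) (X - C a) = A at *
    generalize algebraMap ℂ[X] (RatFunc ℂ) (X - C b) = B at *
    field_simp
    ring

/-- For a nonzero rational function vanishing at infinity to order at least two
(`deg num + 2 ≤ deg denom`), only finitely many residues are nonzero and the total sum
of residues vanishes: `Σ_{a ∈ ℂ} res_a(f) = 0`. -/
theorem sum_of_residues_eq_zero (f : RatFunc ℂ) (hf : f ≠ 0)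
    (hdeg : f.num.natDegree + 2 ≤ f.denom.natDegree) :
    {a : ℂ | resAt a f ≠ 0}.Finite ∧ ∑ᶠ a : ℂ, resAt a f = 0 := by
  obtain ⟨n, hn⟩ : ∃ n, f.denom.natDegree = n + 1 := ⟨f.denom.natDegree - 1, by omega⟩
  have hsplit := IsAlgClosed.splits f.denom
  have hprod : (f.denom.roots.map fun a => X - C a).prod = f.denom :=
    (hsplit.eq_prod_roots_of_monic f.monic_denom).symm
  have h := hasResidueSum_div_prod n f.denom.roots f.num
    (by rw [← hsplit.natDegree_eq_card_roots, hn]) (by omega)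
  rwa [hprod, RatFunc.num_div_denom, coeff_eq_zero_of_natDegree_lt (by omega)] at h

end
end
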